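/- Let M be simply connected... (corrected): Let X = M/G where M is the 7-torus ℝ/4ℤ × T⁶ and G = D₄ × ℤ₂² is the group generated by F[t,z] = [t+1, f(z)], κ[t,z] = [1-t, z̄], ι₁, ι₂ as in the construction. Then π₁(X) is trivial. -/

import Mathlib

noncomputable section

open Complex

/-- The Gaussian lattice Γ = ℤ⟨1, i⟩ in ℂ. -/
def GammaLat : AddSubgroup ℂ := AddSubgroup.closure {1, Complex.I}

/-- The complex torus ℂ/Γ. -/
abbrev CTorus := ℂ ⧸ GammaLat

/-- T⁶ = (ℂ/Γ)³. -/
abbrev T6 := Fin 3 → CTorus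

/-- The projection ℂ³ → T⁶. -/
def pr6 : (Fin 3 → ℂ) → T6 := fun z i => QuotientAddGroup.mk (z i)

/-- The lift of f to ℂ³ : (z₁,z₂,z₃) ↦ (iz₁, iz₂, -z₃). -/
def fC : (Fin 3 → ℂ) → (Fin 3 → ℂ) := fun z => ![Complex.I * z 0, Complex.I * z 1, -(z 2)]

/-- The relation on ℝ × ℂ³ whose equivalence closure gives the orbifold
X = (ℝ/4ℤ × T⁶)/(D₄ × ℤ₂²): generators are F(t,z) = (t+1, f z), κ(t,z) = (1-t, z̄),
ι₁(t,z) = (t, -z₁, -z₂, z₃+1/2), ι₂(t,z) = (t, -z₁, -z₂, z₃+i/2), together with the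
lattice translations defining T⁶. -/
def RelX : (ℝ × (Fin 3 → ℂ)) → (ℝ × (Fin 3 → ℂ)) → Prop := fun p q =>
  q = (p.1 + 1, fC p.2) ∨
  q = (1 - p.1, fun i => (starRingEnd ℂ) (p.2 i)) ∨
  q = (p.1, ![-(p.2 0), -(p.2 1), p.2 2 + 1/2]) ∨
  q = (p.1, ![-(p.2 0), -(p.2 1), p.2 2 + Complex.I / 2]) ∨
  (q.1 = p.1 ∧ ∃ γ : Fin 3 → ℂ, (∀ i, γ i ∈ GammaLat) ∧ q.2 = p.2 + γ)

/-- The orbifold X = 𝕋⁷/(D₄ × ℤ₂²) of the construction. -/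
abbrev OrbifoldX : Type := Quot RelX

section DiscontinuousQuotient

open Set Topology unitInterval

variable {V X : Type*} [NormedAddCommGroup V] {π : V → X}

/-- A quotient map whose fibres are the orbits of the group of isometries preserving it. -/
def IsIsometricOrbitMap (π : V → X) : Prop :=
  ∀ v w, π v = π w → ∃ g : V ≃ᵢ V, (∀ u, π (g u) = π u) ∧ g v = w

theorem IsIsometricOrbitMap.map_lineMap_eq [NormedSpace ℝ V] (h : IsIsometricOrbitMap π)
    {x : V} {r : ℝ}
    (hr : ∀ w ∈ Metric.ball x (2 * r), π w = π x → w = x) {v w : V} (hv : v ∈ Metric.ball x r)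
    (hw : w ∈ Metric.ball x r) (hvw : π v = π w) (s : ℝ) :
    π (AffineMap.lineMap v x s) = π (AffineMap.lineMap w x s) := by
  obtain ⟨g, hg, rfl⟩ := h v w hvw
  have hgx : g x = x := by
    refine hr _ ?_ (hg x)
    have h₁ := dist_triangle (g x) (g v) x
    rw [g.dist_eq, dist_comm x v] at h₁
    rw [Metric.mem_ball] at hv hw ⊢
    linarith
  have hlin : g (AffineMap.lineMap v x s) = AffineMap.lineMap (g v) (g x) s := by
    have := g.toRealAffineIsometryEquiv.toAffineEquiv.apply_lineMap v x s
    exact this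
  rw [hgx] at hlin
  rw [← hlin, hg]

variable [TopologicalSpace X]

/-- The path `γ` is homotopic, relative to its endpoints, to the projection of a path starting at
any prescribed point over its source. -/
def LiftsUpToHomotopy (hπ : Continuous π) {x y : X} (γ : Path x y) : Prop :=
  ∀ v (hv : π v = x), ∃ (w : V) (hw : π w = y) (δ : Path v w),
    γ.Homotopic ((δ.map hπ).cast hv.symm hw.symm)

/-- The points `v` and `w` are joined by a path whose projection is a nullhomotopic loop. -/
def JoinedByNullhomotopic (hπ : Continuous π) (v w : V) : Prop :=
  ∃ (h : π v = π w) (δ : Path v w), (δ.map hπ).Homotopic ((Path.refl (π v)).cast rfl h.symm)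

theorem IsIsometricOrbitMap.isOpenMap (hπ : IsQuotientMap π) (h : IsIsometricOrbitMap π) :
    IsOpenMap π := by
  intro U hU
  rw [← hπ.isOpen_preimage]
  have : π ⁻¹' (π '' U) = ⋃ g : {g : V ≃ᵢ V // ∀ u, π (g u) = π u}, g.1 '' U := by
    ext v
    simp only [mem_preimage, mem_image, mem_iUnion, Subtype.exists]
    constructor
    · rintro ⟨u, hu, huv⟩
      obtain ⟨g, hg, rfl⟩ := h u v huv
      exact ⟨g, hg, u, hu, rfl⟩
    · rintro ⟨g, hg, u, hu, rfl⟩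
      exact ⟨u, hu, (hg u).symm⟩
  rw [this]
  exact isOpen_iUnion fun g => g.1.toHomeomorph.isOpenMap U hU

theorem Path.homotopic_of_range_subset {U : Set X} [SimplyConnectedSpace U] {x y : X}
    (γ δ : Path x y) (hγ : range γ ⊆ U) (hδ : range δ ⊆ U) : γ.Homotopic δ := by
  let lift (ε : Path x y) (hε : range ε ⊆ U) :
      Path (⟨x, hγ ⟨0, γ.source⟩⟩ : U) ⟨y, hγ ⟨1, γ.target⟩⟩ :=
    { toFun := fun t => ⟨ε t, hε ⟨t, rfl⟩⟩
      continuous_toFun := ε.continuous.subtype_mk _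
      source' := Subtype.ext ε.source
      target' := Subtype.ext ε.target }
  exact (SimplyConnectedSpace.paths_homotopic (lift γ hγ) (lift δ hδ)).map
    ⟨Subtype.val, continuous_subtype_val⟩

theorem LiftsUpToHomotopy.of_homotopic {hπ : Continuous π} {x y : X} {γ γ' : Path x y}
    (h : LiftsUpToHomotopy hπ γ) (hγ : γ'.Homotopic γ) : LiftsUpToHomotopy hπ γ' := by
  intro v hv
  obtain ⟨w, hw, δ, hδ⟩ := h v hv
  exact ⟨w, hw, δ, hγ.trans hδ⟩

theorem LiftsUpToHomotopy.trans {hπ : Continuous π} {x y z : X} {γ : Path x y} {γ' : Path y z}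
    (h : LiftsUpToHomotopy hπ γ) (h' : LiftsUpToHomotopy hπ γ') :
    LiftsUpToHomotopy hπ (γ.trans γ') := by
  intro v hv
  obtain ⟨w, hw, δ, hδ⟩ := h v hv
  obtain ⟨u, hu, δ', hδ'⟩ := h' w hw
  refine ⟨u, hu, δ.trans δ', ?_⟩
  rw [Path.map_trans, Path.cast_trans _ _ _ hw.symm]
  exact hδ.hcomp hδ'

theorem JoinedByNullhomotopic.refl (hπ : Continuous π) (v : V) : JoinedByNullhomotopic hπ v v :=
  ⟨rfl, Path.refl v, Path.Homotopic.refl _⟩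

theorem JoinedByNullhomotopic.symm {hπ : Continuous π} {v w : V}
    (h : JoinedByNullhomotopic hπ v w) : JoinedByNullhomotopic hπ w v := by
  obtain ⟨h, δ, hδ⟩ := h
  refine ⟨h.symm, δ.symm, ?_⟩
  have : (Path.refl (π w)).cast rfl h = ((Path.refl (π v)).cast rfl h.symm).symm := by
    ext s
    exact h.symm
  rw [this]
  exact hδ.symm₂

theorem JoinedByNullhomotopic.trans {hπ : Continuous π} {u v w : V}
    (h : JoinedByNullhomotopic hπ u v) (h' : JoinedByNullhomotopic hπ v w) :
    JoinedByNullhomotopic hπ u w := by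
  obtain ⟨h, δ, hδ⟩ := h
  obtain ⟨h', δ', hδ'⟩ := h'
  refine ⟨h.trans h', δ.trans δ', ?_⟩
  rw [Path.map_trans]
  have aux : ∀ {a b c : X} (hab : a = b) (hbc : b = c),
      ((Path.refl a).cast rfl hab.symm).trans ((Path.refl b).cast rfl hbc.symm) =
        (Path.refl a).cast rfl (hab.trans hbc).symm := by
    rintro a _ _ rfl rfl
    exact Path.refl_trans_refl
  exact aux h h' ▸ hδ.hcomp hδ'

variable [NormedSpace ℝ V]

theorem IsIsometricOrbitMap.contractibleSpace_image_ball (hπ : IsQuotientMap π)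
    (h : IsIsometricOrbitMap π) {x : V} {r : ℝ} (hr₀ : 0 < r)
    (hr : ∀ w ∈ Metric.ball x (2 * r), π w = π x → w = x) :
    ContractibleSpace (π '' Metric.ball x r) := by
  have hx : x ∈ Metric.ball x r := Metric.mem_ball_self hr₀
  let ρ : Metric.ball x r → π '' Metric.ball x r := fun v => ⟨π v, mem_image_of_mem π v.2⟩
  have hρc : Continuous ρ := (hπ.continuous.comp continuous_subtype_val).subtype_mk _
  have hρ : IsOpenQuotientMap ρ := by
    refine ⟨?_, hρc, ?_⟩
    · rintro ⟨_, v, hv, rfl⟩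
      exact ⟨⟨v, hv⟩, rfl⟩
    · have : IsOpenMap (fun v : Metric.ball x r => π v) :=
        (h.isOpenMap hπ).comp Metric.isOpen_ball.isOpenMap_subtype_val
      exact IsOpenMap.subtype_mk this _
  let H₀ : C(I × Metric.ball x r, π '' Metric.ball x r) :=
    { toFun := fun q => ρ ⟨AffineMap.lineMap q.2.1 x q.1.1,
        (convex_ball x r).lineMap_mem q.2.2 hx q.1.2⟩
      continuous_toFun := by
        refine hρc.comp (Continuous.subtype_mk ?_ _)
        simp only [AffineMap.lineMap_apply_module]
        fun_prop }
  have hq : IsQuotientMap (Prod.map id ρ : I × Metric.ball x r → I × π '' Metric.ball x r) :=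
    (IsOpenQuotientMap.id.prodMap hρ).isQuotientMap
  have hcompat : ∀ a b, Prod.map id ρ a = Prod.map id ρ b → H₀ a = H₀ b := by
    rintro ⟨s, v⟩ ⟨t, w⟩ hab
    obtain ⟨rfl, hvw⟩ := Prod.ext_iff.1 hab
    exact Subtype.ext (h.map_lineMap_eq hr v.2 w.2 (congrArg Subtype.val hvw) s)
  let H : C(I × π '' Metric.ball x r, π '' Metric.ball x r) :=
    IsQuotientMap.lift (f := ⟨_, hq.continuous⟩) hq H₀ hcompat
  have hH : ∀ s v, H (s, ρ v) = H₀ (s, v) := fun s v =>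
    DFunLike.congr_fun (IsQuotientMap.lift_comp (f := ⟨_, hq.continuous⟩) hq H₀ hcompat) (s, v)
  rw [contractible_iff_id_nullhomotopic]
  refine ⟨ρ ⟨x, hx⟩, ⟨⟨H, ?_, ?_⟩⟩⟩
  · intro y
    obtain ⟨v, rfl⟩ := hρ.surjective y
    change H (0, ρ v) = ρ v
    rw [hH]
    exact congrArg ρ (Subtype.ext (AffineMap.lineMap_apply_zero _ _))
  · intro y
    obtain ⟨v, rfl⟩ := hρ.surjective y
    change H (1, ρ v) = ρ ⟨x, hx⟩
    rw [hH]
    exact congrArg ρ (Subtype.ext (AffineMap.lineMap_apply_one _ _))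

theorem IsIsometricOrbitMap.liftsUpToHomotopy_of_range_subset (hπ : IsQuotientMap π)
    (h : IsIsometricOrbitMap π) {c : V} {r : ℝ} (hr₀ : 0 < r)
    (hr : ∀ w ∈ Metric.ball c (2 * r), π w = π c → w = c) {x y : X} (γ : Path x y)
    (hγ : range γ ⊆ π '' Metric.ball c r) : LiftsUpToHomotopy hπ.continuous γ := by
  have := h.contractibleSpace_image_ball hπ hr₀ hr
  rintro v rfl
  obtain ⟨v₀, hv₀, hv⟩ := hγ ⟨0, γ.source⟩
  obtain ⟨w₀, hw₀, rfl⟩ := hγ ⟨1, γ.target⟩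
  obtain ⟨g, hg, rfl⟩ := h v₀ v hv
  obtain ⟨δ, hδ⟩ := ((convex_ball c r).isPathConnected ⟨c, Metric.mem_ball_self hr₀⟩).joinedIn
    v₀ hv₀ w₀ hw₀
  refine ⟨g w₀, hg w₀, δ.map g.continuous, Path.homotopic_of_range_subset γ _ hγ ?_⟩
  rintro _ ⟨t, rfl⟩
  exact ⟨δ t, hδ t, (hg _).symm⟩

theorem IsIsometricOrbitMap.liftsUpToHomotopy (hπ : IsQuotientMap π) (h : IsIsometricOrbitMap π)
    (hdisc : ∀ x, ∀ᶠ w in 𝓝 x, π w = π x → w = x) {x y : X} (γ : Path x y) :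
    LiftsUpToHomotopy hπ.continuous γ := by
  have hrad : ∀ c : V, ∃ r > 0, ∀ w ∈ Metric.ball c (2 * r), π w = π c → w = c := by
    intro c
    obtain ⟨ε, hε, H⟩ := Metric.eventually_nhds_iff_ball.1 (hdisc c)
    exact ⟨ε / 2, half_pos hε, fun w hw => H w (by rwa [mul_div_cancel₀ ε two_ne_zero] at hw)⟩
  choose r hr₀ hr using hrad
  obtain ⟨t, ht₀, hmono, ⟨n, hn⟩, ht⟩ := exists_monotone_Icc_subset_open_cover_unitInterval
    (c := fun c : V => γ ⁻¹' (π '' Metric.ball c (r c)))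
    (fun c => (h.isOpenMap hπ _ Metric.isOpen_ball).preimage γ.continuous) (by
      intro s _
      obtain ⟨c, hc⟩ := hπ.surjective (γ s)
      exact mem_iUnion.2 ⟨c, c, Metric.mem_ball_self (hr₀ c), hc⟩)
  have key : ∀ m, LiftsUpToHomotopy hπ.continuous (γ.subpath (t 0) (t m)) := by
    intro m
    induction m with
    | zero =>
      intro v hv
      refine ⟨v, hv, Path.refl v, ?_⟩
      have : ((Path.refl v).map hπ.continuous).cast hv.symm hv.symm = Path.refl (γ (t 0)) := by
        ext s
        exact hv
      rw [Path.subpath_self, this]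
    | succ m ih =>
      obtain ⟨c, hc⟩ := ht m
      refine (ih.trans (h.liftsUpToHomotopy_of_range_subset hπ (hr₀ c) (hr c)
        (γ.subpath (t m) (t (m + 1))) ?_)).of_homotopic
        ⟨(Path.Homotopy.subpathTransSubpath γ (t 0) (t m) (t (m + 1))).symm⟩
      rw [Path.range_subpath_of_le _ _ _ (hmono m.le_succ)]
      exact image_subset_iff.2 hc
  have hlift := key n
  rw [ht₀, hn n le_rfl, Path.subpath_zero_one] at hlift
  intro v hv
  obtain ⟨w, hw, δ, hδ⟩ := hlift v (hv.trans γ.source.symm)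
  exact ⟨w, hw.trans γ.target, δ, hδ.pathCast γ.source.symm γ.target.symm⟩

theorem joinedByNullhomotopic_of_fixedPoint (hπ : Continuous π) {s : V → V} (hs : Continuous s)
    (hsπ : ∀ u, π (s u) = π u) {x : V} (hx : s x = x) (v : V) :
    JoinedByNullhomotopic hπ v (s v) := by
  let δ := PathConnectedSpace.somePath v x
  refine ⟨(hsπ v).symm, δ.trans ((δ.symm.map hs).cast hx.symm rfl), ?_⟩
  have : (δ.trans ((δ.symm.map hs).cast hx.symm rfl)).map hπ =
      ((δ.map hπ).trans (δ.map hπ).symm).cast rfl (hsπ v) := by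
    rw [Path.map_trans, Path.cast_trans _ _ _ rfl]
    congr 1
    ext t
    exact hsπ _
  rw [this]
  exact Path.Homotopic.pathCast ⟨(Path.Homotopy.reflTransSymm _).symm⟩ _ _

/-- Armstrong's theorem for discontinuous actions by isometries on a normed space: if every two
points of an orbit are joined by a path whose projection is nullhomotopic, then the orbit space is
simply connected. -/
theorem IsIsometricOrbitMap.simplyConnectedSpace (hπ : IsQuotientMap π)
    (h : IsIsometricOrbitMap π) (hdisc : ∀ x, ∀ᶠ w in 𝓝 x, π w = π x → w = x)
    (hnull : ∀ v w, π v = π w → JoinedByNullhomotopic hπ.continuous v w) :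
    SimplyConnectedSpace X := by
  rw [simply_connected_iff_loops_nullhomotopic]
  refine ⟨hπ.surjective.pathConnectedSpace hπ.continuous, fun x γ => ?_⟩
  obtain ⟨v, rfl⟩ := hπ.surjective x
  obtain ⟨w, hw, δ, hδ⟩ := h.liftsUpToHomotopy hπ hdisc γ v rfl
  obtain ⟨h', δ', hδ'⟩ := hnull v w hw.symm
  refine hδ.trans (Path.Homotopic.trans ?_ (hδ'.pathCast rfl hw.symm))
  exact ((SimplyConnectedSpace.paths_homotopic δ δ').map ⟨π, hπ.continuous⟩).pathCast rfl hw.symm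

end DiscontinuousQuotient

theorem mem_GammaLat {γ : ℂ} (h : γ ∈ GammaLat) : ∃ m n : ℤ, γ = m + n * I := by
  obtain ⟨m, n, rfl⟩ := AddSubgroup.mem_closure_pair.1 h
  exact ⟨m, n, by simp⟩

/-- The isometry of `ℝ × ℂ³` acting by the given isometries on the coordinates. -/
def coordIsometry (s : ℝ ≃ᵢ ℝ) (e : Fin 3 → ℂ ≃ᵢ ℂ) : ℝ × (Fin 3 → ℂ) ≃ᵢ ℝ × (Fin 3 → ℂ) where
  toEquiv := s.toEquiv.prodCongr (Equiv.piCongrRight fun i => (e i).toEquiv)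
  isometry_toFun := s.isometry.prodMap (.piMap _ fun i => (e i).isometry)

/-- Multiplication by `i` on `ℂ`. -/
def mulIIsometry : ℂ ≃ᵢ ℂ :=
  (rotation ⟨I, by simp [Submonoid.unitSphere]⟩).toIsometryEquiv

/-- The lift of `F` to `ℝ × ℂ³`. -/
def isometryF : ℝ × (Fin 3 → ℂ) ≃ᵢ ℝ × (Fin 3 → ℂ) :=
  coordIsometry (IsometryEquiv.addRight 1) ![mulIIsometry, mulIIsometry, IsometryEquiv.neg ℂ]

/-- The lift of `κ` to `ℝ × ℂ³`. -/
def isometryKappa : ℝ × (Fin 3 → ℂ) ≃ᵢ ℝ × (Fin 3 → ℂ) :=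
  coordIsometry (IsometryEquiv.subLeft 1) fun _ => conjLIE.toIsometryEquiv

/-- The lift of `ι₁` (for `b = 1/2`) and `ι₂` (for `b = i/2`) to `ℝ × ℂ³`. -/
def isometryIota (b : ℂ) : ℝ × (Fin 3 → ℂ) ≃ᵢ ℝ × (Fin 3 → ℂ) :=
  coordIsometry (IsometryEquiv.refl ℝ)
    ![IsometryEquiv.neg ℂ, IsometryEquiv.neg ℂ, IsometryEquiv.addRight b]

/-- The translation of the second factor of `ℝ × ℂ³` by `γ`. -/
def isometryTranslation (γ : Fin 3 → ℂ) : ℝ × (Fin 3 → ℂ) ≃ᵢ ℝ × (Fin 3 → ℂ) :=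
  coordIsometry (IsometryEquiv.refl ℝ) fun i => IsometryEquiv.addRight (γ i)

theorem isometryF_apply (p : ℝ × (Fin 3 → ℂ)) : isometryF p = (p.1 + 1, fC p.2) := by
  refine Prod.ext rfl ?_
  ext i
  fin_cases i <;> rfl

theorem isometryKappa_apply (p : ℝ × (Fin 3 → ℂ)) :
    isometryKappa p = (1 - p.1, fun i => (starRingEnd ℂ) (p.2 i)) :=
  rfl

theorem isometryIota_apply (b : ℂ) (p : ℝ × (Fin 3 → ℂ)) :
    isometryIota b p = (p.1, ![-(p.2 0), -(p.2 1), p.2 2 + b]) := by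
  refine Prod.ext rfl ?_
  ext i
  fin_cases i <;> rfl

theorem isometryTranslation_apply (γ : Fin 3 → ℂ) (p : ℝ × (Fin 3 → ℂ)) :
    isometryTranslation γ p = (p.1, p.2 + γ) :=
  rfl

theorem mk_isometryF (p : ℝ × (Fin 3 → ℂ)) : Quot.mk RelX (isometryF p) = Quot.mk RelX p :=
  (Quot.sound (r := RelX) (Or.inl (isometryF_apply p))).symm

theorem mk_isometryKappa (p : ℝ × (Fin 3 → ℂ)) :
    Quot.mk RelX (isometryKappa p) = Quot.mk RelX p :=
  (Quot.sound (r := RelX) (Or.inr (Or.inl (isometryKappa_apply p)))).symm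

theorem mk_isometryIota_half (p : ℝ × (Fin 3 → ℂ)) :
    Quot.mk RelX (isometryIota (1 / 2) p) = Quot.mk RelX p :=
  (Quot.sound (r := RelX) (Or.inr (Or.inr (Or.inl (isometryIota_apply _ p))))).symm

theorem mk_isometryIota_I_div_two (p : ℝ × (Fin 3 → ℂ)) :
    Quot.mk RelX (isometryIota (I / 2) p) = Quot.mk RelX p :=
  (Quot.sound (r := RelX) (Or.inr (Or.inr (Or.inr (Or.inl (isometryIota_apply _ p)))))).symm

theorem mk_isometryTranslation {γ : Fin 3 → ℂ} (hγ : ∀ i, γ i ∈ GammaLat)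
    (p : ℝ × (Fin 3 → ℂ)) : Quot.mk RelX (isometryTranslation γ p) = Quot.mk RelX p :=
  (Quot.sound (r := RelX) (a := p) (b := isometryTranslation γ p)
    (Or.inr (Or.inr (Or.inr (Or.inr ⟨rfl, γ, hγ, rfl⟩))))).symm

theorem RelX.exists_isometryEquiv {p q : ℝ × (Fin 3 → ℂ)} (h : RelX p q) :
    ∃ g : ℝ × (Fin 3 → ℂ) ≃ᵢ ℝ × (Fin 3 → ℂ),
      (∀ u, Quot.mk RelX (g u) = Quot.mk RelX u) ∧ g p = q := by
  rcases h with h | h | h | h | ⟨h, γ, hγ, h'⟩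
  · exact ⟨isometryF, mk_isometryF, (isometryF_apply p).trans h.symm⟩
  · exact ⟨isometryKappa, mk_isometryKappa, (isometryKappa_apply p).trans h.symm⟩
  · exact ⟨isometryIota _, mk_isometryIota_half, (isometryIota_apply _ p).trans h.symm⟩
  · exact ⟨isometryIota _, mk_isometryIota_I_div_two, (isometryIota_apply _ p).trans h.symm⟩
  · exact ⟨isometryTranslation γ, mk_isometryTranslation hγ, Prod.ext h.symm h'.symm⟩

theorem isIsometricOrbitMap_mk : IsIsometricOrbitMap (Quot.mk RelX) := by
  intro v w hvw
  induction Quot.eqvGen_exact hvw with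
  | rel p q h => exact h.exists_isometryEquiv
  | refl p => exact ⟨IsometryEquiv.refl _, fun _ => rfl, rfl⟩
  | symm p q h ih =>
    obtain ⟨g, hg, rfl⟩ := ih (Quot.eqvGen_sound h)
    refine ⟨g.symm, fun u => ?_, g.symm_apply_apply p⟩
    rw [← hg, g.apply_symm_apply]
  | trans p q r h h' ih ih' =>
    obtain ⟨g, hg, rfl⟩ := ih (Quot.eqvGen_sound h)
    obtain ⟨g', hg', rfl⟩ := ih' (Quot.eqvGen_sound h')
    exact ⟨g.trans g', fun u => (hg' _).trans (hg u), rfl⟩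

/-- A continuous function of a real variable invariant under `a ↦ -a` and `a ↦ a + 1/2`. -/
def cosInvariant (a : ℝ) : ℝ := Real.cos (4 * Real.pi * a)

theorem cosInvariant_neg (a : ℝ) : cosInvariant (-a) = cosInvariant a := by
  simp [cosInvariant]

theorem cosInvariant_add_int_div_two (a : ℝ) (n : ℤ) :
    cosInvariant (a + n / 2) = cosInvariant a := by
  rw [cosInvariant, cosInvariant, ← Real.cos_add_int_mul_two_pi (4 * Real.pi * a) n]
  ring_nf

theorem eventually_cosInvariant_ne (a k : ℝ) :
    ∀ᶠ c in nhds a, cosInvariant c = k → c = a := by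
  have han : AnalyticOnNhd ℝ cosInvariant Set.univ := fun x _ => by
    unfold cosInvariant
    fun_prop
  rcases (han a trivial).eventually_eq_or_eventually_ne (analyticAt_const (v := k)) with h | h
  · have heq := han.eq_of_eventuallyEq (g := fun _ => k) (fun _ _ => analyticAt_const) h
    have h₀ : Real.cos 0 = k := by simpa [cosInvariant] using congrFun heq 0
    have h₁ : Real.cos Real.pi = k := by
      rw [← congrFun heq (1 / 4), cosInvariant]
      ring_nf
    rw [Real.cos_zero] at h₀
    rw [Real.cos_pi] at h₁
    linarith
  · rw [eventually_nhdsWithin_iff] at h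
    filter_upwards [h] with c hc hck
    by_contra hne
    exact hc hne hck

/-- A function on `ℂ` invariant under the coordinate actions of the orbifold group. -/
def sym2Invariant (z : ℂ) : Sym2 ℝ := s(cosInvariant z.re, cosInvariant z.im)

theorem sym2Invariant_neg (z : ℂ) : sym2Invariant (-z) = sym2Invariant z := by
  simp [sym2Invariant, cosInvariant_neg]

theorem sym2Invariant_conj (z : ℂ) : sym2Invariant ((starRingEnd ℂ) z) = sym2Invariant z := by
  simp [sym2Invariant, cosInvariant_neg]

theorem sym2Invariant_I_mul (z : ℂ) : sym2Invariant (I * z) = sym2Invariant z := by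
  simp [sym2Invariant, cosInvariant_neg, Sym2.eq_swap]

theorem sym2Invariant_add (z : ℂ) (m n : ℤ) :
    sym2Invariant (z + (m / 2 + n / 2 * I)) = sym2Invariant z := by
  have hre : (z + (m / 2 + n / 2 * I)).re = z.re + m / 2 := by simp
  have him : (z + (m / 2 + n / 2 * I)).im = z.im + n / 2 := by simp
  rw [sym2Invariant, sym2Invariant, hre, him, cosInvariant_add_int_div_two,
    cosInvariant_add_int_div_two]

theorem eventually_sym2Invariant_ne (z : ℂ) :
    ∀ᶠ w in nhds z, sym2Invariant w = sym2Invariant z → w = z := by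
  have hre := Complex.continuous_re.tendsto z
  have him := Complex.continuous_im.tendsto z
  filter_upwards [hre (eventually_cosInvariant_ne z.re (cosInvariant z.re)),
    hre (eventually_cosInvariant_ne z.re (cosInvariant z.im)),
    him (eventually_cosInvariant_ne z.im (cosInvariant z.re)),
    him (eventually_cosInvariant_ne z.im (cosInvariant z.im))] with w h₁ h₂ h₃ h₄ h
  rcases Sym2.eq_iff.1 h with ⟨h, h'⟩ | ⟨h, h'⟩
  · exact Complex.ext (h₁ h) (h₄ h')
  · exact Complex.ext (h₂ h) (h₃ h')

theorem RelX.invariant_eq {p q : ℝ × (Fin 3 → ℂ)} (h : RelX p q) :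
    cosInvariant q.1 = cosInvariant p.1 ∧
      ∀ i, sym2Invariant (q.2 i) = sym2Invariant (p.2 i) := by
  have h_one : ∀ a : ℝ, cosInvariant (a + 1) = cosInvariant a := fun a => by
    simpa using cosInvariant_add_int_div_two a 2
  rcases h with rfl | rfl | rfl | rfl | ⟨h, γ, hγ, h'⟩
  · refine ⟨h_one _, fun i => ?_⟩
    fin_cases i
    · exact sym2Invariant_I_mul _
    · exact sym2Invariant_I_mul _
    · exact sym2Invariant_neg _
  · refine ⟨?_, fun i => sym2Invariant_conj _⟩
    rw [← cosInvariant_neg p.1, ← h_one (-p.1)]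
    ring_nf
  · refine ⟨rfl, fun i => ?_⟩
    fin_cases i
    · exact sym2Invariant_neg _
    · exact sym2Invariant_neg _
    · simpa using sym2Invariant_add (p.2 2) 1 0
  · refine ⟨rfl, fun i => ?_⟩
    fin_cases i
    · exact sym2Invariant_neg _
    · exact sym2Invariant_neg _
    · have := sym2Invariant_add (p.2 2) 0 1
      simp only [Int.cast_zero, zero_div, zero_add, Int.cast_one, one_div_mul_eq_div] at this
      exact this
  · refine ⟨by rw [h], fun i => ?_⟩
    obtain ⟨m, n, hmn⟩ := mem_GammaLat (hγ i)
    have := sym2Invariant_add (p.2 i) (2 * m) (2 * n)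
    rw [h', Pi.add_apply, hmn, ← this]
    congr 2
    push_cast
    ring

theorem eventually_mk_eq_imp_eq (p : ℝ × (Fin 3 → ℂ)) :
    ∀ᶠ q in nhds p, Quot.mk RelX q = Quot.mk RelX p → q = p := by
  have hfst := continuous_fst.tendsto p
  have hsnd := fun i => ((continuous_apply i).comp continuous_snd).tendsto p
  filter_upwards [hfst (eventually_cosInvariant_ne p.1 (cosInvariant p.1)),
    Filter.eventually_all.2 fun i => hsnd i (eventually_sym2Invariant_ne (p.2 i))]
    with q h₁ h₂ hqp
  have h₁' := congrArg (Quot.lift (fun q => cosInvariant q.1)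
    fun _ _ h => h.invariant_eq.1.symm) hqp
  have h₂' := fun i => congrArg (Quot.lift (fun q => sym2Invariant (q.2 i))
    fun _ _ h => (h.invariant_eq.2 i).symm) hqp
  exact Prod.ext (h₁ h₁') (funext fun i => h₂ i (h₂' i))

/-- The property of being joined by a path whose projection to the orbifold is nullhomotopic. -/
abbrev JoinedX (p q : ℝ × (Fin 3 → ℂ)) : Prop :=
  JoinedByNullhomotopic (π := Quot.mk RelX) continuous_quot_mk p q

theorem joinedX_isometryKappa (p : ℝ × (Fin 3 → ℂ)) : JoinedX p (isometryKappa p) := by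
  refine joinedByNullhomotopic_of_fixedPoint _ isometryKappa.continuous mk_isometryKappa
    (x := (1 / 2, 0)) ?_ p
  rw [isometryKappa_apply]
  refine Prod.ext (by norm_num) ?_
  ext i
  simp

theorem joinedX_isometryF (p : ℝ × (Fin 3 → ℂ)) : JoinedX p (isometryF p) := by
  refine JoinedByNullhomotopic.trans ?_ (joinedX_isometryKappa (isometryF p)).symm
  refine joinedByNullhomotopic_of_fixedPoint _ (isometryF.trans isometryKappa).continuous
    (fun u => (mk_isometryKappa _).trans (mk_isometryF u)) (x := 0) ?_ p
  rw [IsometryEquiv.trans_apply, isometryF_apply, isometryKappa_apply]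
  refine Prod.ext (by simp) ?_
  ext i
  fin_cases i <;> simp [fC]

theorem joinedX_isometryIota_half (p : ℝ × (Fin 3 → ℂ)) :
    JoinedX p (isometryIota (1 / 2) p) := by
  refine JoinedByNullhomotopic.trans ?_
    ((joinedX_isometryF (isometryIota (1 / 2) p)).trans (joinedX_isometryKappa _)).symm
  refine joinedByNullhomotopic_of_fixedPoint _
    ((isometryIota (1 / 2)).trans (isometryF.trans isometryKappa)).continuous
    (fun u => (mk_isometryKappa _).trans ((mk_isometryF _).trans (mk_isometryIota_half u)))
    (x := (0, ![0, 0, -(1 / 4 : ℝ)])) ?_ p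
  rw [IsometryEquiv.trans_apply, IsometryEquiv.trans_apply, isometryIota_apply, isometryF_apply,
    isometryKappa_apply]
  refine Prod.ext (by simp) ?_
  ext i
  fin_cases i <;> simp [fC, Complex.ext_iff, -ofReal_div]
  norm_num

theorem joinedX_isometryIota_I_div_two (p : ℝ × (Fin 3 → ℂ)) :
    JoinedX p (isometryIota (I / 2) p) := by
  refine JoinedByNullhomotopic.trans ?_ (joinedX_isometryKappa (isometryIota (I / 2) p)).symm
  refine joinedByNullhomotopic_of_fixedPoint _
    ((isometryIota (I / 2)).trans isometryKappa).continuous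
    (fun u => (mk_isometryKappa _).trans (mk_isometryIota_I_div_two u))
    (x := (1 / 2, ![0, 0, -((1 / 4 : ℝ) * I)])) ?_ p
  rw [IsometryEquiv.trans_apply, isometryIota_apply, isometryKappa_apply]
  refine Prod.ext (by norm_num) ?_
  ext i
  fin_cases i <;> simp [Complex.ext_iff, -ofReal_div, -map_div₀]
  norm_num

theorem intCast_add_mem_GammaLat (m n : ℤ) : (m + n * I : ℂ) ∈ GammaLat :=
  AddSubgroup.mem_closure_pair.2 ⟨m, n, by simp⟩

theorem joinedX_translation_imaginary (n : Fin 3 → ℤ) (p : ℝ × (Fin 3 → ℂ)) :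
    JoinedX p (isometryTranslation (fun i => n i * I) p) := by
  have hγ : ∀ i, (n i * I : ℂ) ∈ GammaLat := fun i => by
    simpa using intCast_add_mem_GammaLat 0 (n i)
  refine JoinedByNullhomotopic.trans ?_ (joinedX_isometryKappa (isometryTranslation _ p)).symm
  refine joinedByNullhomotopic_of_fixedPoint _
    ((isometryTranslation _).trans isometryKappa).continuous
    (fun u => (mk_isometryKappa _).trans (mk_isometryTranslation hγ u))
    (x := (1 / 2, fun i => -((n i / 2 : ℝ) * I))) ?_ p
  rw [IsometryEquiv.trans_apply, isometryTranslation_apply, isometryKappa_apply]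
  refine Prod.ext (by norm_num) ?_
  ext i
  simp [Complex.ext_iff, -ofReal_div]
  ring

theorem joinedX_translation_real_third (m : ℤ) (p : ℝ × (Fin 3 → ℂ)) :
    JoinedX p (isometryTranslation ![0, 0, m] p) := by
  have hγ : ∀ i, (![0, 0, m] : Fin 3 → ℂ) i ∈ GammaLat := fun i => by
    fin_cases i
    · exact zero_mem _
    · exact zero_mem _
    · simpa using intCast_add_mem_GammaLat m 0
  refine JoinedByNullhomotopic.trans ?_
    ((joinedX_isometryF (isometryTranslation _ p)).trans (joinedX_isometryKappa _)).symm
  refine joinedByNullhomotopic_of_fixedPoint _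
    ((isometryTranslation _).trans (isometryF.trans isometryKappa)).continuous
    (fun u => (mk_isometryKappa _).trans ((mk_isometryF _).trans (mk_isometryTranslation hγ u)))
    (x := (0, ![0, 0, -(m / 2 : ℝ)])) ?_ p
  rw [IsometryEquiv.trans_apply, IsometryEquiv.trans_apply, isometryTranslation_apply,
    isometryF_apply, isometryKappa_apply]
  refine Prod.ext (by simp) ?_
  ext i
  fin_cases i <;> simp [fC, Complex.ext_iff, -ofReal_div]
  ring

theorem joinedX_translation_real_first_second (m n : ℤ) (p : ℝ × (Fin 3 → ℂ)) :
    JoinedX p (isometryTranslation ![m, n, 0] p) := by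
  have hγ : ∀ i, (![m, n, 0] : Fin 3 → ℂ) i ∈ GammaLat := fun i => by
    fin_cases i
    · simpa using intCast_add_mem_GammaLat m 0
    · simpa using intCast_add_mem_GammaLat n 0
    · exact zero_mem _
  refine JoinedByNullhomotopic.trans ?_ ((joinedX_isometryF (isometryTranslation _ p)).trans
    ((joinedX_isometryF _).trans (joinedX_isometryKappa _))).symm
  refine joinedByNullhomotopic_of_fixedPoint _
    ((isometryTranslation _).trans (isometryF.trans (isometryF.trans isometryKappa))).continuous
    (fun u => (mk_isometryKappa _).trans
      ((mk_isometryF _).trans ((mk_isometryF _).trans (mk_isometryTranslation hγ u))))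
    (x := (-1 / 2, ![-(m / 2 : ℝ), -(n / 2 : ℝ), 0])) ?_ p
  rw [IsometryEquiv.trans_apply, IsometryEquiv.trans_apply, IsometryEquiv.trans_apply,
    isometryTranslation_apply, isometryF_apply, isometryF_apply, isometryKappa_apply]
  refine Prod.ext (by norm_num) ?_
  ext i
  fin_cases i <;> simp [fC, Complex.ext_iff, -ofReal_div] <;> ring

theorem joinedX_isometryTranslation {γ : Fin 3 → ℂ} (hγ : ∀ i, γ i ∈ GammaLat)
    (p : ℝ × (Fin 3 → ℂ)) : JoinedX p (isometryTranslation γ p) := by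
  choose m n hmn using fun i => mem_GammaLat (hγ i)
  have : isometryTranslation γ p = isometryTranslation (fun i => n i * I)
      (isometryTranslation ![m 0, m 1, 0] (isometryTranslation ![0, 0, m 2] p)) := by
    simp only [isometryTranslation_apply]
    refine Prod.ext rfl ?_
    ext i
    fin_cases i <;> simp [hmn, Matrix.vecHead, Matrix.vecTail] <;> ring
  rw [this]
  exact (joinedX_translation_real_third _ _).trans
    ((joinedX_translation_real_first_second _ _ _).trans (joinedX_translation_imaginary _ _))

theorem RelX.joinedX {p q : ℝ × (Fin 3 → ℂ)} (h : RelX p q) : JoinedX p q := by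
  rcases h with h | h | h | h | ⟨h, γ, hγ, h'⟩
  · rw [h, ← isometryF_apply]
    exact joinedX_isometryF p
  · rw [h, ← isometryKappa_apply]
    exact joinedX_isometryKappa p
  · rw [h, ← isometryIota_apply]
    exact joinedX_isometryIota_half p
  · rw [h, ← isometryIota_apply]
    exact joinedX_isometryIota_I_div_two p
  · have : q = isometryTranslation γ p := Prod.ext h h'
    rw [this]
    exact joinedX_isometryTranslation hγ p

theorem joinedX_of_mk_eq {p q : ℝ × (Fin 3 → ℂ)} (hpq : Quot.mk RelX p = Quot.mk RelX q) :
    JoinedX p q := by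
  induction Quot.eqvGen_exact hpq with
  | rel p q h => exact h.joinedX
  | refl p => exact JoinedByNullhomotopic.refl _ p
  | symm p q h ih => exact (ih (Quot.eqvGen_sound h)).symm
  | trans p q r h h' ih ih' =>
    exact (ih (Quot.eqvGen_sound h)).trans (ih' (Quot.eqvGen_sound h'))

/-- The orbifold X of the construction is simply connected: π₁(X) = 1. -/
theorem stmt17 : SimplyConnectedSpace OrbifoldX := by
  exact isIsometricOrbitMap_mk.simplyConnectedSpace isQuotientMap_quot_mk eventually_mk_eq_imp_eq
    fun _ _ => joinedX_of_mk_eq
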